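/- Let F be a finite field of characteristic 3, G = T_{3m} with m = 3k+1, and H = ⟨x⟩. Then Δ(G,H) is a semisimple ring (a two-sided ideal of FG which, as a ring, is semisimple). -/

import Mathlib

/-- Relations of the presentation `T_{3m} = ⟨x, y | x^m = y^3 = 1, y⁻¹xy = x^t⟩`. -/
def T3mRels (m t : ℕ) : Set (FreeGroup (Fin 2)) :=
  {FreeGroup.of 0 ^ m, FreeGroup.of 1 ^ 3,
   (FreeGroup.of 1)⁻¹ * FreeGroup.of 0 * FreeGroup.of 1 * (FreeGroup.of 0 ^ t)⁻¹}

/-- The group `T_{3m}` given by the presentation `⟨x, y | x^m = y^3 = 1, y⁻¹xy = x^t⟩`. -/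
abbrev T3m (m t : ℕ) : Type := PresentedGroup (T3mRels m t)

/-- The generator `x` of `T_{3m}`. -/
def xg (m t : ℕ) : T3m m t := PresentedGroup.of 0

/-- The generator `y` of `T_{3m}`. -/
def yg (m t : ℕ) : T3m m t := PresentedGroup.of 1

section helper
open MonoidAlgebra

theorem aux_semisimple {F G M ι : Type*} [Field F] [Group G] [Fintype ι] [AddCommGroup M]
    [Module F M] [Module (MonoidAlgebra F G) M] [IsScalarTower F (MonoidAlgebra F G) M]
    (u : ι → G) (c : MonoidAlgebra F G) (S : Set G) (hS : Subgroup.closure S = ⊤)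
    (hperm : ∀ s ∈ S, ∃ σ : Equiv.Perm ι, ∀ i, s * u i = u (σ i))
    (hc : ∀ v : M, (∑ i, (single (u i) (1 : F) * c * single (u i)⁻¹ (1 : F))) • v = v) :
    IsSemisimpleModule (MonoidAlgebra F G) M := by
  rw [isSemisimpleModule_iff]
  refine ⟨fun N => ?_⟩
  obtain ⟨p, hp⟩ := (N.restrictScalars F).subtype.exists_leftInverse_of_injective
    (LinearMap.ker_eq_bot.2 Subtype.val_injective)
  have hp' : ∀ n : N.restrictScalars F, p n = n := fun n => LinearMap.congr_fun hp n
  let q : M → M := fun v => ∑ i, single (u i) (1 : F) •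
    ((p ((c * single (u i)⁻¹ (1 : F)) • v) : N.restrictScalars F) : M)
  have hqN : ∀ v, q v ∈ N := fun v =>
    N.sum_mem fun i _ => N.smul_mem _ (p _).2
  have hqadd : ∀ v w, q (v + w) = q v + q w := by
    intro v w
    simp only [q, smul_add, map_add, Submodule.coe_add, Finset.sum_add_distrib]
  have hqF : ∀ (a : F) v, q (a • v) = a • q v := by
    intro a v
    simp only [q, Finset.smul_sum]
    refine Finset.sum_congr rfl fun i _ => ?_
    rw [smul_algebra_smul_comm, map_smul, Submodule.coe_smul, smul_algebra_smul_comm]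
  have hqS : ∀ s ∈ S, ∀ v, q (single s (1 : F) • v) = single s (1 : F) • q v := by
    intro s hs v
    obtain ⟨σ, hσ⟩ := hperm s hs
    simp only [q, Finset.smul_sum]
    rw [← Equiv.sum_comp σ]
    refine Finset.sum_congr rfl fun i _ => ?_
    rw [← hσ, smul_smul, smul_smul, mul_assoc, single_mul_single, single_mul_single]
    simp
  have hqG : ∀ g : G, ∀ v, q (single g (1 : F) • v) = single g (1 : F) • q v := by
    intro g
    have hg : g ∈ Subgroup.closure S := hS ▸ Subgroup.mem_top g
    induction hg using Subgroup.closure_induction with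
    | mem x hx => exact hqS x hx
    | one => intro v; rw [← one_def, one_smul, one_smul]
    | mul x y _ _ hx hy =>
      intro v
      have : (single (x * y) (1 : F)) = single x 1 * single y 1 := by
        rw [single_mul_single, one_mul]
      rw [this, mul_smul, hx, hy, mul_smul]
    | inv x _ hx =>
      intro v
      have h1 : (single x (1 : F)) * single x⁻¹ 1 = 1 := by
        rw [single_mul_single, one_mul, mul_inv_cancel, one_def]
      have h2 : (single x⁻¹ (1 : F)) * single x 1 = 1 := by
        rw [single_mul_single, one_mul, inv_mul_cancel, one_def]
      have := hx (single x⁻¹ (1 : F) • v)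
      rw [smul_smul, h1, one_smul] at this
      rw [this, smul_smul, h2, one_smul]
  have hqA : ∀ (r : MonoidAlgebra F G) v, q (r • v) = r • q v := by
    intro r v
    induction r using MonoidAlgebra.induction_on with
    | of g => exact hqG g v
    | add a b ha hb => rw [add_smul, hqadd, ha, hb, add_smul]
    | smul a b hb => rw [smul_assoc, hqF, hb, smul_assoc]
  let Q : M →ₗ[MonoidAlgebra F G] N :=
    { toFun := fun v => ⟨q v, hqN v⟩
      map_add' := fun v w => Subtype.ext (hqadd v w)
      map_smul' := fun r v => Subtype.ext (hqA r v) }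
  refine ⟨LinearMap.ker Q, LinearMap.isCompl_of_proj (f := Q) fun n => Subtype.ext ?_⟩
  change q n = n
  conv_rhs => rw [← hc n]
  rw [Finset.sum_smul]
  refine Finset.sum_congr rfl fun i _ => ?_
  have := hp' ⟨(c * single (u i)⁻¹ (1 : F)) • (n : M), N.smul_mem _ n.2⟩
  simp only at this
  rw [this, smul_smul, mul_assoc]

/-- orbit selector -/
theorem aux_select (m t : ℕ) [NeZero m] (F : Type*) [Field F] (ht : (t : ZMod m) ^ 3 = 1)
    (hu : IsUnit ((t : ZMod m) - 1)) :
    ∃ f : ZMod m → F, f 0 = 0 ∧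
      ∀ a, a ≠ 0 → f a + f (t * a) + f (t ^ 2 * a) = 1 := by
  classical
  refine ⟨fun a => if a.val < ((t : ZMod m) * a).val ∧ a.val < ((t : ZMod m) ^ 2 * a).val
    then 1 else 0, by simp, fun a ha => ?_⟩
  have e1 : (t : ZMod m) * (t * a) = t ^ 2 * a := by ring
  have e2 : (t : ZMod m) ^ 2 * (t * a) = a := by
    rw [← mul_assoc, ← pow_succ, ht, one_mul]
  have e3 : (t : ZMod m) * (t ^ 2 * a) = a := by
    rw [← mul_assoc, ← pow_succ', ht, one_mul]
  have e4 : (t : ZMod m) ^ 2 * (t ^ 2 * a) = t * a := by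
    rw [← e1, ← mul_assoc, ← pow_succ, ht, one_mul]
  have n1 : (t : ZMod m) * a ≠ a := by
    intro h
    apply ha
    rw [← hu.mul_right_eq_zero, sub_mul, h, one_mul, sub_self]
  have n2 : (t : ZMod m) ^ 2 * a ≠ t * a := by
    intro h
    apply n1
    have := congrArg (fun z => (t : ZMod m) ^ 2 * z) h
    simp only [e2, e4] at this
    exact this
  have n3 : (t : ZMod m) ^ 2 * a ≠ a := by
    intro h
    have := congrArg (fun z => (t : ZMod m) * z) h
    simp only [e3] at this
    exact n1 this.symm
  simp only [e1, e2, e3, e4]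
  have v1 := fun h => n1 (ZMod.val_injective m h)
  have v2 := fun h => n2 (ZMod.val_injective m h)
  have v3 := fun h => n3 (ZMod.val_injective m h)
  generalize ((t : ZMod m) * a).val = B at *
  generalize ((t : ZMod m) ^ 2 * a).val = C at *
  generalize a.val = A at *
  rcases lt_or_gt_of_ne v1 with h1 | h1 <;> rcases lt_or_gt_of_ne v2 with h2 | h2 <;>
    rcases lt_or_gt_of_ne v3 with h3 | h3 <;>
    first
      | omega
      | simp [h1, h2, h3, h1.not_gt, h2.not_gt, h3.not_gt]

theorem aux_kill {F G ι : Type*} [Field F] [Group G] [Fintype ι] (X : ι → G) (H : Subgroup G)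
    [H.Normal] (hH : ∀ h ∈ H, ∃ σ : Equiv.Perm ι, ∀ i, X i * h = X (σ i))
    (v : MonoidAlgebra F G)
    (hv : MonoidAlgebra.mapDomainRingHom F (QuotientGroup.mk' H) v = 0) :
    (∑ i, single (X i) (1 : F)) * v = 0 := by
  set E : MonoidAlgebra F G := ∑ i, single (X i) (1 : F) with hE
  have key : ∀ h ∈ H, E * single h (1 : F) = E := by
    intro h hh
    obtain ⟨σ, hσ⟩ := hH h hh
    rw [hE, Finset.sum_mul]
    simp only [single_mul_single, one_mul, hσ]
    exact Equiv.sum_comp σ (fun i => (single (X i) (1 : F) : MonoidAlgebra F G))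
  let L : MonoidAlgebra F (G ⧸ H) →+ MonoidAlgebra F G :=
    liftNC (algebraMap F (MonoidAlgebra F G)).toAddMonoidHom
      (fun x : G ⧸ H => E * single (Quotient.out x) (1 : F))
  have hL : AddMonoidHom.mulLeft E =
      L.comp (MonoidAlgebra.mapDomainRingHom F (QuotientGroup.mk' H)).toAddMonoidHom := by
    refine MonoidAlgebra.addMonoidHom_ext fun g a => ?_
    have h1 : (g * (Quotient.out (g : G ⧸ H))⁻¹) ∈ H := by
      have : ((Quotient.out (g : G ⧸ H) : G) : G ⧸ H) = (g : G ⧸ H) := Quotient.out_eq _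
      rw [← QuotientGroup.eq_one_iff, QuotientGroup.mk_mul, QuotientGroup.mk_inv, this,
        mul_inv_cancel]
    have h2 : E * single (Quotient.out (g : G ⧸ H)) (1 : F) = E * single g 1 := by
      conv_lhs => rw [← key _ h1]
      rw [mul_assoc, single_mul_single, one_mul, inv_mul_cancel_right]
    have h3 : (MonoidAlgebra.mapDomainRingHom F (QuotientGroup.mk' H)) (single g a)
        = single (g : G ⧸ H) a := by simp
    change E * single g a = L ((MonoidAlgebra.mapDomainRingHom F (QuotientGroup.mk' H)) _)
    rw [h3]
    change _ = liftNC _ _ _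
    rw [liftNC_single, h2]
    change _ = algebraMap F (MonoidAlgebra F G) a * _
    rw [← Algebra.smul_def, ← mul_smul_comm, smul_single, smul_eq_mul, mul_one]
  have h4 := DFunLike.congr_fun hL v
  change E * v = L (MonoidAlgebra.mapDomainRingHom F (QuotientGroup.mk' H) v) at h4
  rw [h4, hv, map_zero]

theorem aux_main {F G : Type*} [Field F] [CharP F 3] [Group G] (x y : G) (m t k : ℕ)
    (ht1 : 1 ≤ t) (hm : m = 3 * k + 1) (ht : t ^ 3 % m = 1 % m)
    (hgcd : Nat.gcd m (t - 1) = 1) [hN : (Subgroup.zpowers x).Normal]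
    (hx : x ^ m = 1) (hy : y ^ 3 = 1) (hxy : y⁻¹ * x * y = x ^ t)
    (hgen : Subgroup.closure {x, y} = ⊤) :
    IsSemisimpleModule (MonoidAlgebra F G)
      (RingHom.ker (MonoidAlgebra.mapDomainRingHom F
        (QuotientGroup.mk' (Subgroup.zpowers x)))) := by
  haveI : NeZero m := ⟨by omega⟩
  have htz : (t : ZMod m) ^ 3 = 1 := by
    have : ((t ^ 3 : ℕ) : ZMod m) = (1 : ℕ) := (ZMod.natCast_eq_natCast_iff' _ _ _).2 ht
    simpa using this
  have hu : IsUnit ((t : ZMod m) - 1) := by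
    have : IsUnit ((t - 1 : ℕ) : ZMod m) :=
      (ZMod.isUnit_iff_coprime _ _).2 (Nat.Coprime.symm hgcd)
    rwa [Nat.cast_sub ht1, Nat.cast_one] at this
  have hmF : (m : F) = 1 := by
    have : ((3 : ℕ) : F) = 0 := CharP.cast_eq_zero F 3
    rw [hm, Nat.cast_add, Nat.cast_mul, this]; simp
  obtain ⟨f, f0, hf⟩ := aux_select m t F htz hu
  have hmod : ∀ n : ℕ, x ^ (n % m) = x ^ n := fun n => (pow_eq_pow_mod n hx).symm
  let X : ZMod m → G := fun a => x ^ a.val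
  have Xcast : ∀ n : ℕ, X n = x ^ n := fun n => by
    simp only [X, ZMod.val_natCast, hmod]
  have Xadd : ∀ a b, X (a + b) = X a * X b := fun a b => by
    simp only [X, ZMod.val_add, hmod, pow_add]
  have X0 : X 0 = 1 := by simp [X]
  have hyX : ∀ a, y⁻¹ * X a * y = X (t * a) := fun a => by
    have h1 : (t : ZMod m) * a = ((t * a.val : ℕ) : ZMod m) := by simp
    rw [h1, Xcast, pow_mul, ← hxy]
    have := conj_pow (a := y⁻¹) (b := x) (i := a.val)
    rw [inv_inv] at this
    exact this.symm
  have hyX' : ∀ a, y * X a = X (t ^ 2 * a) * y := fun a => by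
    have h1 := hyX (t ^ 2 * a)
    rw [← mul_assoc, ← pow_succ', htz, one_mul] at h1
    rw [← h1]; group
  let u : ZMod m × Fin 3 → G := fun p => X p.1 * y ^ (p.2 : ℕ)
  let c : MonoidAlgebra F G := - ∑ b, single (X b) (f b)
  have tinv : (t : ZMod m) * t ^ 2 = 1 := by rw [← pow_succ', htz]
  have tinv' : (t : ZMod m) ^ 2 * t = 1 := by rw [← pow_succ, htz]
  let τ : Equiv.Perm (ZMod m) :=
    { toFun := fun a => t ^ 2 * a
      invFun := fun a => t * a
      left_inv := fun a => by simp only [← mul_assoc, tinv, one_mul]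
      right_inv := fun a => by simp only [← mul_assoc, tinv', one_mul] }
  have hXcomm : ∀ a b, X a * X b * (X a)⁻¹ = X b := fun a b => by
    rw [← Xadd, add_comm, Xadd, mul_inv_cancel_right]
  have hy1 : ∀ b, y * X b * y⁻¹ = X (t ^ 2 * b) := fun b => by
    rw [hyX', mul_inv_cancel_right]
  have hy2 : ∀ b, y ^ 2 * X b * (y ^ 2)⁻¹ = X (t * b) := fun b => by
    have h1 : y ^ 2 = y⁻¹ := by
      rw [eq_inv_iff_mul_eq_one, ← pow_succ, hy]
    rw [h1, inv_inv, hyX]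
  refine aux_semisimple u c {x, y} hgen ?_ ?_
  · rintro s (rfl | rfl)
    · refine ⟨(Equiv.addLeft 1).prodCongr (Equiv.refl _), fun p => ?_⟩
      have h1 : X 1 = s := by have := Xcast 1; simpa using this
      change s * (X p.1 * y ^ (p.2 : ℕ)) = X (1 + p.1) * y ^ (p.2 : ℕ)
      rw [Xadd, h1, mul_assoc]
    · refine ⟨τ.prodCongr (finRotate 3), fun p => ?_⟩
      obtain ⟨a, i⟩ := p
      change s * (X a * s ^ (i : ℕ)) = X (t ^ 2 * a) * s ^ ((finRotate 3 i : Fin 3) : ℕ)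
      rw [← mul_assoc, hyX', mul_assoc, ← pow_succ']
      congr 1
      fin_cases i
      · rfl
      · rfl
      · exact hy.trans (pow_zero s).symm
  · have hsum : (∑ p, (single (u p) (1 : F) * c * single (u p)⁻¹ (1 : F)))
        = 1 - ∑ a, single (X a) (1 : F) := by
      have e1 : ∀ p, (single (u p) (1 : F) * c * single (u p)⁻¹ (1 : F))
          = - ∑ b, single (y ^ (p.2 : ℕ) * X b * (y ^ (p.2 : ℕ))⁻¹) (f b) := by
        rintro ⟨a, i⟩
        have hconj : ∀ b, u (a, i) * X b * (u (a, i))⁻¹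
            = y ^ (i : ℕ) * X b * (y ^ (i : ℕ))⁻¹ := by
          intro b
          have h5 : ∃ b', y ^ (i : ℕ) * X b * (y ^ (i : ℕ))⁻¹ = X b' := by
            fin_cases i
            · exact ⟨b, by simp⟩
            · exact ⟨_, by simpa using hy1 b⟩
            · exact ⟨_, hy2 b⟩
          obtain ⟨b', hb'⟩ := h5
          rw [hb', ← hXcomm a b', ← hb']
          simp only [u, mul_inv_rev, mul_assoc]
        simp only [c, mul_neg, neg_mul, Finset.mul_sum, Finset.sum_mul, single_mul_single,
          one_mul, mul_one, hconj]
      simp only [e1]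
      rw [Fintype.sum_prod_type]
      simp only [Finset.sum_const, Finset.card_univ, ZMod.card]
      rw [← Nat.cast_smul_eq_nsmul F, hmF, one_smul, Fin.sum_univ_three]
      simp only [Fin.val_zero, Fin.val_one, Fin.val_two, pow_zero, pow_one, hy1, hy2, one_mul,
        inv_one, mul_one]
      have e2 : ∑ b, (single (X (t ^ 2 * b)) (f b) : MonoidAlgebra F G)
          = ∑ b, single (X b) (f (t * b)) := by
        rw [← Equiv.sum_comp τ (fun b => (single (X b) (f (t * b)) : MonoidAlgebra F G))]
        refine Finset.sum_congr rfl fun b _ => ?_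
        change _ = single (X (t ^ 2 * b)) (f (t * (t ^ 2 * b)))
        rw [← mul_assoc (t : ZMod m), tinv, one_mul]
      have e3 : ∑ b, (single (X (t * b)) (f b) : MonoidAlgebra F G)
          = ∑ b, single (X b) (f (t ^ 2 * b)) := by
        rw [← Equiv.sum_comp τ.symm (fun b => (single (X b) (f (t ^ 2 * b)) : MonoidAlgebra F G))]
        refine Finset.sum_congr rfl fun b _ => ?_
        change _ = single (X (t * b)) (f (t ^ 2 * (t * b)))
        rw [← mul_assoc ((t : ZMod m) ^ 2), tinv', one_mul]
      rw [e2, e3, ← neg_add, ← neg_add, ← Finset.sum_add_distrib, ← Finset.sum_add_distrib]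
      have e4 : ∀ b, (single (X b) (f b) + single (X b) (f (t * b))
          + single (X b) (f (t ^ 2 * b)) : MonoidAlgebra F G)
          = single (X b) 1 - if b = 0 then 1 else 0 := by
        intro b
        rw [← single_add, ← single_add]
        split_ifs with hb
        · subst hb
          simp [f0, X0, one_def]
        · rw [hf b hb, sub_zero]
      simp only [e4, Finset.sum_sub_distrib, Finset.sum_ite_eq', Finset.mem_univ, if_true,
        neg_sub]
    intro v
    rw [hsum, sub_smul, one_smul, sub_eq_self]
    refine Subtype.ext ?_
    refine aux_kill X (Subgroup.zpowers x) ?_ v.1 v.2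
    rintro h ⟨n, rfl⟩
    have hn : ∃ b, x ^ n = X b := by
      refine ⟨((n % m).toNat : ℕ), ?_⟩
      rw [Xcast, ← zpow_natCast, Int.toNat_of_nonneg (Int.emod_nonneg _ (by omega))]
      conv_lhs => rw [← Int.emod_add_mul_ediv n m]
      rw [zpow_add, zpow_mul, zpow_natCast, hx, one_zpow, mul_one]
    obtain ⟨b, hb⟩ := hn
    refine ⟨Equiv.addRight b, fun i => ?_⟩
    change X i * x ^ n = X (i + b)
    rw [hb, Xadd]
end helper

/-- For a finite field `F` of characteristic 3, `G = T_{3m}` and `H = ⟨x⟩`, the relative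
augmentation ideal `Δ(G,H)` is semisimple (as a module over `FG`, equivalently as a ring
with its own identity). -/
theorem aug_semisimple (F : Type*) [Field F] [Fintype F] [CharP F 3] (m t k : ℕ)
    (ht1 : 1 ≤ t) (hm : m = 3 * k + 1) (ht : t ^ 3 % m = 1 % m)
    (hgcd : Nat.gcd m (t - 1) = 1) [hN : (Subgroup.zpowers (xg m t)).Normal] :
    IsSemisimpleModule (MonoidAlgebra F (T3m m t))
      (RingHom.ker (MonoidAlgebra.mapDomainRingHom F
        (QuotientGroup.mk' (Subgroup.zpowers (xg m t))))) := by
  have hrel : ∀ r ∈ T3mRels m t, PresentedGroup.mk (T3mRels m t) r = 1 := fun r hr =>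
    PresentedGroup.one_of_mem hr
  refine aux_main (xg m t) (yg m t) m t k ht1 hm ht hgcd ?_ ?_ ?_ ?_
  · have := hrel (FreeGroup.of 0 ^ m) (by simp [T3mRels])
    rwa [map_pow] at this
  · have := hrel (FreeGroup.of 1 ^ 3) (by simp [T3mRels])
    rwa [map_pow] at this
  · have := hrel ((FreeGroup.of 1)⁻¹ * FreeGroup.of 0 * FreeGroup.of 1 * (FreeGroup.of 0 ^ t)⁻¹)
      (by simp [T3mRels])
    rw [map_mul, map_inv, map_pow, mul_inv_eq_one, map_mul, map_mul, map_inv] at this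
    exact this
  · rw [← PresentedGroup.closure_range_of (T3mRels m t)]
    congr 1
    ext g
    simp only [Set.mem_insert_iff, Set.mem_singleton_iff, Set.mem_range, Fin.exists_fin_two,
      xg, yg]
    exact or_congr eq_comm eq_comm
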